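/- For every q ∈ (1,∞) there exists a constant C = C(d,q) < ∞ such that for every integer m ∈ ℕ and every function g : ℝ × ℤᵈ → ℝ which is continuously differentiable in time, one has ‖g − (g)_{Q_{3^m}}‖_{L^q(Q_{3^m})} ≤ C 3^m ‖∇g‖_{L^q(Q_{3^m})} + C 3^m ‖∂_t g‖_{L^q((−3^{2m},0), W^{−1,q}(Λ_{3^m}))}, where (g)_{Q_{3^m}} denotes the space–time average of g over Q_{3^m}. -/

import Mathlib

open MeasureTheory

noncomputable section

/-- The lattice `ℤᵈ`. -/
abbrev Zlat (d : ℕ) := Fin d → ℤ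

/-- The box `Λ_L = {−L,…,L}^d`. -/
def box (d L : ℕ) : Finset (Zlat d) := Finset.Icc (fun _ => -(L : ℤ)) (fun _ => (L : ℤ))

/-- The exterior boundary `∂⁺Λ_L`. -/
def bdry (d L : ℕ) : Set (Zlat d) :=
  {y | y ∉ box d L ∧ ∃ x ∈ box d L, ∑ i, (x i - y i) ^ 2 = 1}

/-- The unit vector `e_i` of `ℤᵈ`. -/
def eZ (d : ℕ) (i : Fin d) : Zlat d := fun j => if j = i then 1 else 0

/-- Discrete gradient on `ℤᵈ`. -/
def dgradZ (d : ℕ) (u : Zlat d → ℝ) (x : Zlat d) : Fin d → ℝ :=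
  fun i => u (x + eZ d i) - u x

/-- Euclidean norm `|∇u(x)|` of the discrete gradient. -/
def gradNormZ (d : ℕ) (u : Zlat d → ℝ) (x : Zlat d) : ℝ :=
  Real.sqrt (∑ i, dgradZ d u x i ^ 2)

/-- Scaled norm `‖v‖_{L^q(Λ_L)}`. -/
def sLq (d L : ℕ) (q : ℝ) (v : Zlat d → ℝ) : ℝ :=
  (((2 * L + 1 : ℝ) ^ d)⁻¹ * ∑ x ∈ box d L, |v x| ^ q) ^ (1 / q)

/-- Scaled norm `‖v‖_{W^{1,q}(Λ_L)}`. -/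
def sW1q (d L : ℕ) (q : ℝ) (v : Zlat d → ℝ) : ℝ :=
  (L : ℝ)⁻¹ * sLq d L q v + sLq d L q (gradNormZ d v)

/-- Scaled negative norm `‖w‖_{W^{−1,q}(Λ_L)}` (the test functions are taken in `W^{1,q'}`
with `q'` the conjugate exponent of `q`, and vanish on `∂⁺Λ_L`). -/
def sWm1q (d L : ℕ) (q : ℝ) (w : Zlat d → ℝ) : ℝ :=
  sSup {A | ∃ v : Zlat d → ℝ, (∀ y ∈ bdry d L, v y = 0) ∧
    sW1q d L (q / (q - 1)) v ≤ 1 ∧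
    A = ((2 * L + 1 : ℝ) ^ d)⁻¹ * ∑ x ∈ box d L, w x * v x}

/-- Parabolic norm `‖u‖_{L^q(Q_L)}`. -/
def pLq (d L : ℕ) (q : ℝ) (u : ℝ → Zlat d → ℝ) : ℝ :=
  (((L : ℝ) ^ 2)⁻¹ * ∫ t in (-(L : ℝ) ^ 2)..0, sLq d L q (u t) ^ q) ^ (1 / q)

/-- Parabolic norm `‖u‖_{L^q((−L²,0),W^{−1,q}(Λ_L))}`. -/
def pLWm1 (d L : ℕ) (q : ℝ) (u : ℝ → Zlat d → ℝ) : ℝ :=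
  (((L : ℝ) ^ 2)⁻¹ * ∫ t in (-(L : ℝ) ^ 2)..0, sWm1q d L q (u t) ^ q) ^ (1 / q)

/-- The space–time average `(u)_{Q_L}` of a function over the parabolic cylinder
`(s₀−L²,s₀) × (y₀+Λ_L)`. -/
def cylAvgAt (d L : ℕ) (s₀ : ℝ) (y₀ : Zlat d) (u : ℝ → Zlat d → ℝ) : ℝ :=
  ((L : ℝ) ^ 2 * (2 * L + 1 : ℝ) ^ d)⁻¹ *
    ∫ t in (s₀ - (L : ℝ) ^ 2)..s₀, ∑ x ∈ box d L, u t (y₀ + x)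

lemma mem_box {d L : ℕ} {x : Zlat d} : x ∈ box d L ↔ ∀ i, -(L : ℤ) ≤ x i ∧ x i ≤ L := by
  simp only [box, Finset.mem_Icc, Pi.le_def, forall_and]

lemma card_box (d L : ℕ) : ((box d L).card : ℝ) = (2 * L + 1 : ℝ) ^ d := by
  have h : ((L : ℤ) + 1 - -(L : ℤ)).toNat = 2 * L + 1 := by omega
  rw [box, Pi.card_Icc]
  simp only [Int.card_Icc, h, Finset.prod_const, Finset.card_univ, Fintype.card_fin]
  push_cast
  rfl

lemma box_volume_pos (d L : ℕ) : (0 : ℝ) < (2 * L + 1 : ℝ) ^ d := by positivity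

lemma abs_sub_le_sum_Ico (f : ℤ → ℝ) {a b : ℤ} (h : a ≤ b) :
    |f b - f a| ≤ ∑ i ∈ Finset.Ico a b, |f (i + 1) - f i| := by
  induction b, h using Int.leInduction with
  | base => simp
  | succ n hn ih =>
    rw [← Finset.insert_Ico_right_eq_Ico_add_one hn, Finset.sum_insert (by simp)]
    have := abs_sub_le (f (n + 1)) (f n) (f a)
    linarith

lemma abs_sub_le_sum_Icc (f : ℤ → ℝ) {l r a b : ℤ} (ha : a ∈ Finset.Icc l r)
    (hb : b ∈ Finset.Icc l r) :
    |f a - f b| ≤ ∑ i ∈ Finset.Icc l r, |f (i + 1) - f i| := by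
  wlog h : b ≤ a generalizing a b
  · rw [abs_sub_comm]
    exact this hb ha (by omega)
  refine (abs_sub_le_sum_Ico f h).trans
    (Finset.sum_le_sum_of_subset_of_nonneg ?_ fun _ _ _ => abs_nonneg _)
  intro i hi
  simp only [Finset.mem_Icc, Finset.mem_Ico] at *
  omega

/-- The point whose first `n` coordinates are those of `y` and whose others are those of `x`. -/
def mixCoord {d : ℕ} (n : ℕ) (x y : Zlat d) : Zlat d := fun i => if (i : ℕ) < n then y i else x i

lemma mixCoord_mem_box {d L n : ℕ} {x y : Zlat d} (hx : x ∈ box d L) (hy : y ∈ box d L) :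
    mixCoord n x y ∈ box d L := by
  rw [mem_box] at *
  intro i
  unfold mixCoord
  split_ifs
  exacts [hy i, hx i]

lemma mixCoord_mixCoord {d n : ℕ} (x y : Zlat d) :
    mixCoord n (mixCoord n x y) (mixCoord n y x) = x := by
  ext i
  unfold mixCoord
  split_ifs <;> rfl

lemma mixCoord_succ {d : ℕ} (k : Fin d) (x y : Zlat d) :
    mixCoord (k + 1) x y = Function.update (mixCoord k x y) k (mixCoord k y x k) := by
  ext i
  by_cases h : i = k
  · subst h
    simp [mixCoord]
  · have h' : (i : ℕ) ≠ k := fun e => h (Fin.ext e)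
    rw [Function.update_of_ne h]
    unfold mixCoord
    congr 1
    simp only [eq_iff_iff]
    omega

lemma sum_box_mixCoord {d : ℕ} (L n : ℕ) (H : Zlat d → Zlat d → ℝ) :
    ∑ p ∈ box d L ×ˢ box d L, H (mixCoord n p.1 p.2) (mixCoord n p.2 p.1) =
      ∑ p ∈ box d L ×ˢ box d L, H p.1 p.2 := by
  refine Finset.sum_nbij' (fun p => (mixCoord n p.1 p.2, mixCoord n p.2 p.1))
    (fun p => (mixCoord n p.1 p.2, mixCoord n p.2 p.1)) ?_ ?_ ?_ ?_ ?_ <;>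
  simp only [Finset.mem_product, mixCoord_mixCoord, Prod.mk.eta, implies_true, and_imp]
  · exact fun p h1 h2 => ⟨mixCoord_mem_box h1 h2, mixCoord_mem_box h2 h1⟩
  · exact fun p h1 h2 => ⟨mixCoord_mem_box h1 h2, mixCoord_mem_box h2 h1⟩

lemma update_mem_box {d L : ℕ} {x : Zlat d} (hx : x ∈ box d L) (k : Fin d) {j : ℤ}
    (hj : j ∈ Finset.Icc (-(L : ℤ)) L) : Function.update x k j ∈ box d L := by
  rw [mem_box] at *
  intro i
  by_cases h : i = k
  · subst h
    simpa using hj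
  · simpa [Function.update_of_ne h] using hx i

lemma sum_box_update {d : ℕ} (L : ℕ) (k : Fin d) (F : Zlat d → ℝ) :
    ∑ x ∈ box d L, ∑ j ∈ Finset.Icc (-(L : ℤ)) L, F (Function.update x k j) =
      (2 * L + 1) * ∑ x ∈ box d L, F x := by
  have h : ∑ p ∈ box d L ×ˢ Finset.Icc (-(L : ℤ)) L, F (Function.update p.1 k p.2) =
      ∑ p ∈ box d L ×ˢ Finset.Icc (-(L : ℤ)) L, F p.1 := by
    refine Finset.sum_nbij' (fun p => (Function.update p.1 k p.2, p.1 k))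
      (fun p => (Function.update p.1 k p.2, p.1 k)) ?_ ?_ ?_ ?_ ?_ <;>
    simp only [Finset.mem_product, Function.update_self, Function.update_idem,
      Function.update_eq_self, Prod.mk.eta, implies_true, and_imp]
    · exact fun p h1 h2 => ⟨update_mem_box h1 k h2, Finset.mem_Icc.2 (mem_box.1 h1 k)⟩
    · exact fun p h1 h2 => ⟨update_mem_box h1 k h2, Finset.mem_Icc.2 (mem_box.1 h1 k)⟩
  have hc : ((L : ℤ) + 1 - -(L : ℤ)).toNat = 2 * L + 1 := by omega
  rw [Finset.sum_product, Finset.sum_product] at h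
  rw [h]
  simp only [Finset.sum_const, Int.card_Icc, hc, nsmul_eq_mul]
  rw [← Finset.mul_sum]
  push_cast
  ring

lemma update_add_eZ {d : ℕ} (x : Zlat d) (k : Fin d) (j : ℤ) :
    Function.update x k j + eZ d k = Function.update x k (j + 1) := by
  ext i
  by_cases h : i = k
  · subst h
    simp [eZ]
  · simp [eZ, h]

lemma abs_dgradZ_le_gradNormZ {d : ℕ} (u : Zlat d → ℝ) (x : Zlat d) (k : Fin d) :
    |dgradZ d u x k| ≤ gradNormZ d u x := by
  rw [gradNormZ, ← Real.sqrt_sq_eq_abs]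
  exact Real.sqrt_le_sqrt
    (Finset.single_le_sum (f := fun i => dgradZ d u x i ^ 2) (fun i _ => sq_nonneg _)
      (Finset.mem_univ k))

lemma sum_box_abs_sub_update_le {d : ℕ} (L : ℕ) {q : ℝ} (hq : 1 < q) (u : Zlat d → ℝ)
    (k : Fin d) :
    ∑ p ∈ box d L ×ˢ box d L, |u p.1 - u (Function.update p.1 k (p.2 k))| ^ q ≤
      (2 * L + 1 : ℝ) ^ d * ((2 * L + 1 : ℝ) ^ q * ∑ x ∈ box d L, gradNormZ d u x ^ q) := by
  have hc : ((L : ℤ) + 1 - -(L : ℤ)).toNat = 2 * L + 1 := by omega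
  have hpt : ∀ p ∈ box d L ×ˢ box d L, |u p.1 - u (Function.update p.1 k (p.2 k))| ^ q ≤
      (2 * L + 1 : ℝ) ^ (q - 1) *
        ∑ j ∈ Finset.Icc (-(L : ℤ)) L, |dgradZ d u (Function.update p.1 k j) k| ^ q := by
    intro p hp
    rw [Finset.mem_product] at hp
    have h1 := abs_sub_le_sum_Icc (fun j => u (Function.update p.1 k j))
      (Finset.mem_Icc.2 (mem_box.1 hp.1 k)) (Finset.mem_Icc.2 (mem_box.1 hp.2 k))
    simp only [Function.update_eq_self] at h1
    refine (Real.rpow_le_rpow (abs_nonneg _) h1 (by linarith)).trans ?_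
    have h2 := Real.rpow_sum_le_const_mul_sum_rpow (Finset.Icc (-(L : ℤ)) L)
      (fun j => dgradZ d u (Function.update p.1 k j) k) hq.le
    simp only [Int.card_Icc, hc] at h2
    push_cast at h2
    simpa only [dgradZ, update_add_eZ] using h2
  refine (Finset.sum_le_sum hpt).trans ?_
  rw [Finset.sum_product]
  simp only [Finset.sum_const, nsmul_eq_mul, card_box]
  rw [← Finset.mul_sum, ← Finset.mul_sum, sum_box_update L k fun x => |dgradZ d u x k| ^ q]
  have hL : (0 : ℝ) < 2 * L + 1 := by positivity
  have hS : ∑ x ∈ box d L, |dgradZ d u x k| ^ q ≤ ∑ x ∈ box d L, gradNormZ d u x ^ q := by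
    gcongr with x hx
    exact abs_dgradZ_le_gradNormZ u x k
  have e : (2 * L + 1 : ℝ) ^ q = (2 * L + 1 : ℝ) ^ (q - 1) * (2 * L + 1) := by
    rw [← Real.rpow_add_one hL.ne', sub_add_cancel]
  calc _ = (2 * L + 1 : ℝ) ^ d * ((2 * L + 1 : ℝ) ^ q * ∑ x ∈ box d L, |dgradZ d u x k| ^ q) := by
        rw [e]
        ring
    _ ≤ _ := by gcongr

lemma sum_box_abs_sub_le {d : ℕ} (L : ℕ) {q : ℝ} (hq : 1 < q) (u : Zlat d → ℝ) :
    ∑ p ∈ box d L ×ˢ box d L, |u p.1 - u p.2| ^ q ≤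
      (d : ℝ) ^ (q - 1) * (d * ((2 * L + 1 : ℝ) ^ d *
        ((2 * L + 1 : ℝ) ^ q * ∑ x ∈ box d L, gradNormZ d u x ^ q))) := by
  have hpt : ∀ p ∈ box d L ×ˢ box d L, |u p.1 - u p.2| ^ q ≤ (d : ℝ) ^ (q - 1) *
      ∑ k : Fin d, |u (mixCoord k p.1 p.2) - u (mixCoord (k + 1) p.1 p.2)| ^ q := by
    intro p _
    have h0 : mixCoord 0 p.1 p.2 = p.1 := by
      ext i
      simp [mixCoord]
    have h1 : mixCoord d p.1 p.2 = p.2 := by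
      ext i
      simp [mixCoord]
    have h2 := Finset.sum_range_sub' (fun n => u (mixCoord n p.1 p.2)) d
    simp only [h0, h1] at h2
    rw [← h2, Finset.sum_range]
    refine (Real.rpow_le_rpow (abs_nonneg _) (Finset.abs_sum_le_sum_abs _ _)
      (by linarith)).trans ?_
    have h3 := Real.rpow_sum_le_const_mul_sum_rpow (Finset.univ : Finset (Fin d))
      (fun k => u (mixCoord k p.1 p.2) - u (mixCoord (k + 1) p.1 p.2)) hq.le
    simpa using h3
  refine (Finset.sum_le_sum hpt).trans ?_
  rw [← Finset.mul_sum, Finset.sum_comm]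
  gcongr
  refine (Finset.sum_le_card_nsmul _ _ ((2 * L + 1 : ℝ) ^ d *
    ((2 * L + 1 : ℝ) ^ q * ∑ x ∈ box d L, gradNormZ d u x ^ q)) fun k _ => ?_).trans_eq ?_
  · simp only [mixCoord_succ]
    rw [sum_box_mixCoord L k fun x y => |u x - u (Function.update x k (y k))| ^ q]
    exact sum_box_abs_sub_update_le L hq u k
  · simp

/-- The tent function of height `L + 1` over `Λ_L`. -/
def tent (d L : ℕ) (x : Zlat d) : ℝ := max 0 (L + 1 - ‖x‖)

lemma mem_box_iff_norm_le {d L : ℕ} {x : Zlat d} : x ∈ box d L ↔ ‖x‖ ≤ L := by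
  rw [mem_box, pi_norm_le_iff_of_nonneg (Nat.cast_nonneg L)]
  refine forall_congr' fun i => ?_
  rw [← abs_le, Int.norm_eq_abs]
  norm_cast

lemma tent_nonneg (d L : ℕ) (x : Zlat d) : 0 ≤ tent d L x := le_max_left _ _

lemma tent_le (d L : ℕ) (x : Zlat d) : tent d L x ≤ L + 1 :=
  max_le (by positivity) (by linarith [norm_nonneg x])

lemma tent_eq_zero {d L : ℕ} {x : Zlat d} (hx : x ∈ bdry d L) : tent d L x = 0 := by
  have h := hx.1
  rw [mem_box] at h
  push Not at h
  obtain ⟨i, hi⟩ := h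
  have h1 : (L : ℤ) + 1 ≤ |x i| := by
    by_cases h' : -(L : ℤ) ≤ x i
    · exact (Int.add_one_le_iff.2 (hi h')).trans (le_abs_self _)
    · have := neg_le_abs (x i)
      omega
  have h2 : (L : ℝ) + 1 ≤ ‖x i‖ := by
    rw [Int.norm_eq_abs]
    exact_mod_cast h1
  exact max_eq_left (by linarith [norm_le_pi_norm x i])

lemma norm_eZ_le (d : ℕ) (i : Fin d) : ‖eZ d i‖ ≤ 1 := by
  rw [pi_norm_le_iff_of_nonneg zero_le_one]
  intro j
  unfold eZ
  split_ifs <;> simp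

lemma abs_dgradZ_tent_le (d L : ℕ) (x : Zlat d) (i : Fin d) : |dgradZ d (tent d L) x i| ≤ 1 := by
  have h1 : |tent d L (x + eZ d i) - tent d L x| ≤
      |((L : ℝ) + 1 - ‖x + eZ d i‖) - (L + 1 - ‖x‖)| := by
    unfold tent
    simpa [max_comm] using abs_max_sub_max_le_abs ((L : ℝ) + 1 - ‖x + eZ d i‖) (L + 1 - ‖x‖) 0
  have h2 := abs_norm_sub_norm_le x (x + eZ d i)
  rw [sub_add_cancel_left, norm_neg] at h2
  refine h1.trans ?_
  rw [sub_sub_sub_cancel_left]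
  exact h2.trans (norm_eZ_le d i)

lemma sum_tent_ge (d : ℕ) {L : ℕ} (hL : 1 ≤ L) :
    (L : ℝ) / (2 * 3 ^ d) * (2 * L + 1 : ℝ) ^ d ≤ ∑ x ∈ box d L, tent d L x := by
  have hL' : (1 : ℝ) ≤ L := by exact_mod_cast hL
  have hk : ((L / 2 : ℕ) : ℝ) ≤ L / 2 := Nat.cast_div_le
  have hk2 : (L : ℝ) ≤ 2 * ((L / 2 : ℕ) : ℝ) + 1 := by
    have : L ≤ 2 * (L / 2) + 1 := by omega
    exact_mod_cast this
  have hsub : box d (L / 2) ⊆ box d L := fun x hx => by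
    rw [mem_box_iff_norm_le] at *
    linarith
  calc (L : ℝ) / (2 * 3 ^ d) * (2 * L + 1 : ℝ) ^ d
      ≤ (L : ℝ) / (2 * 3 ^ d) * (3 * (2 * ((L / 2 : ℕ) : ℝ) + 1)) ^ d := by
        gcongr
        linarith
    _ = (2 * ((L / 2 : ℕ) : ℝ) + 1) ^ d * (L / 2) := by
        rw [mul_pow]
        field_simp
    _ = ∑ x ∈ box d (L / 2), (L : ℝ) / 2 := by
        rw [Finset.sum_const, nsmul_eq_mul, card_box]
    _ ≤ ∑ x ∈ box d (L / 2), tent d L x := by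
        refine Finset.sum_le_sum fun x hx => le_max_of_le_right ?_
        rw [mem_box_iff_norm_le] at hx
        linarith
    _ ≤ _ := Finset.sum_le_sum_of_subset_of_nonneg hsub fun x _ _ => tent_nonneg d L x

/-- The average of `u` over `Λ_L` weighted by the tent function. -/
def tentAvg (d L : ℕ) (u : Zlat d → ℝ) : ℝ :=
  (∑ x ∈ box d L, tent d L x * u x) / ∑ x ∈ box d L, tent d L x

lemma sum_tent_pos (d : ℕ) {L : ℕ} (hL : 1 ≤ L) : 0 < ∑ x ∈ box d L, tent d L x := by
  have hL' : (0 : ℝ) < L := by exact_mod_cast hL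
  exact lt_of_lt_of_le (by positivity) (sum_tent_ge d hL)

lemma abs_sub_tentAvg_rpow_le (d : ℕ) {L : ℕ} (hL : 1 ≤ L) {q : ℝ} (hq : 1 < q) (u : Zlat d → ℝ)
    (x : Zlat d) :
    |u x - tentAvg d L u| ^ q ≤
      4 * 3 ^ d * ((2 * L + 1 : ℝ) ^ d)⁻¹ * ∑ y ∈ box d L, |u x - u y| ^ q := by
  have hL' : (1 : ℝ) ≤ L := by exact_mod_cast hL
  have hZ := sum_tent_pos d hL
  have hV := box_volume_pos d L
  set Z := ∑ x ∈ box d L, tent d L x with hZdef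
  have hw : ∑ y ∈ box d L, tent d L y / Z = 1 := by
    rw [← Finset.sum_div, div_self hZ.ne']
  have h1 : u x - tentAvg d L u = ∑ y ∈ box d L, tent d L y / Z * (u x - u y) := by
    simp only [mul_sub]
    rw [Finset.sum_sub_distrib, ← Finset.sum_mul, hw, one_mul, tentAvg, Finset.sum_div]
    congr 1
    exact Finset.sum_congr rfl fun y _ => by ring
  have hw0 : ∀ y ∈ box d L, 0 ≤ tent d L y / Z := fun y _ => div_nonneg (tent_nonneg d L y) hZ.le
  have h2 : |u x - tentAvg d L u| ≤ ∑ y ∈ box d L, tent d L y / Z * |u x - u y| := by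
    rw [h1]
    refine (Finset.abs_sum_le_sum_abs _ _).trans_eq (Finset.sum_congr rfl fun y hy => ?_)
    rw [abs_mul, abs_of_nonneg (hw0 y hy)]
  refine (Real.rpow_le_rpow (abs_nonneg _) h2 (by linarith)).trans ?_
  refine (Real.rpow_arith_mean_le_arith_mean_rpow _ _ _ hw0 hw (fun _ _ => abs_nonneg _)
    hq.le).trans ?_
  rw [Finset.mul_sum]
  gcongr with y hy
  rw [div_le_iff₀ hZ]
  calc tent d L y ≤ 2 * L := (tent_le d L y).trans (by linarith)
    _ = 4 * 3 ^ d * ((2 * L + 1 : ℝ) ^ d)⁻¹ * ((L : ℝ) / (2 * 3 ^ d) * (2 * L + 1 : ℝ) ^ d) := by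
        field_simp
        norm_num
    _ ≤ _ := by
        gcongr
        exact sum_tent_ge d hL

lemma sum_abs_sub_tentAvg_le (d : ℕ) {L : ℕ} (hL : 1 ≤ L) {q : ℝ} (hq : 1 < q) (u : Zlat d → ℝ) :
    ∑ x ∈ box d L, |u x - tentAvg d L u| ^ q ≤
      4 * 3 ^ d * (d : ℝ) ^ (q - 1) * d * 3 ^ q * ((L : ℝ) ^ q *
        ∑ x ∈ box d L, gradNormZ d u x ^ q) := by
  have hL' : (1 : ℝ) ≤ L := by exact_mod_cast hL
  have hV := box_volume_pos d L
  have hS : 0 ≤ ∑ x ∈ box d L, gradNormZ d u x ^ q :=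
    Finset.sum_nonneg fun x _ => Real.rpow_nonneg (Real.sqrt_nonneg _) _
  refine (Finset.sum_le_sum fun x _ => abs_sub_tentAvg_rpow_le d hL hq u x).trans ?_
  rw [← Finset.mul_sum, ← Finset.sum_product (s := box d L) (t := box d L)
    (f := fun p => |u p.1 - u p.2| ^ q)]
  calc _ ≤ 4 * 3 ^ d * ((2 * L + 1 : ℝ) ^ d)⁻¹ * ((d : ℝ) ^ (q - 1) * (d * ((2 * L + 1 : ℝ) ^ d *
        ((2 * L + 1 : ℝ) ^ q * ∑ x ∈ box d L, gradNormZ d u x ^ q)))) := by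
        gcongr
        exact sum_box_abs_sub_le L hq u
    _ = 4 * 3 ^ d * (d : ℝ) ^ (q - 1) * d * ((2 * L + 1 : ℝ) ^ q *
        ∑ x ∈ box d L, gradNormZ d u x ^ q) := by
        field_simp
    _ ≤ 4 * 3 ^ d * (d : ℝ) ^ (q - 1) * d * ((3 * L : ℝ) ^ q *
        ∑ x ∈ box d L, gradNormZ d u x ^ q) := by
        gcongr
        linarith
    _ = _ := by
        rw [Real.mul_rpow (by norm_num) (by linarith)]
        ring

lemma sLq_le {d L : ℕ} {q B : ℝ} (hq : 0 < q) {v : Zlat d → ℝ} (hB : 0 ≤ B)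
    (h : ∀ x ∈ box d L, |v x| ≤ B) : sLq d L q v ≤ B := by
  have hV := box_volume_pos d L
  have h1 : ((2 * L + 1 : ℝ) ^ d)⁻¹ * ∑ x ∈ box d L, |v x| ^ q ≤ B ^ q := by
    rw [inv_mul_le_iff₀ hV, ← card_box, ← nsmul_eq_mul]
    exact Finset.sum_le_card_nsmul _ _ _ fun x hx =>
      Real.rpow_le_rpow (abs_nonneg _) (h x hx) hq.le
  calc sLq d L q v ≤ (B ^ q) ^ (1 / q) := by
        unfold sLq
        gcongr
    _ = B := by rw [one_div, Real.rpow_rpow_inv hB hq.ne']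

lemma sLq_rpow {d L : ℕ} {q : ℝ} (hq : 0 < q) (v : Zlat d → ℝ) :
    sLq d L q v ^ q = ((2 * L + 1 : ℝ) ^ d)⁻¹ * ∑ x ∈ box d L, |v x| ^ q := by
  rw [sLq, one_div, Real.rpow_inv_rpow _ hq.ne']
  positivity

lemma sLq_nonneg (d L : ℕ) (q : ℝ) (v : Zlat d → ℝ) : 0 ≤ sLq d L q v := by
  unfold sLq
  positivity

lemma abs_le_of_sLq_le {d L : ℕ} {q B : ℝ} (hq : 0 < q) {v : Zlat d → ℝ}
    (h : sLq d L q v ≤ B) {x : Zlat d} (hx : x ∈ box d L) :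
    |v x| ≤ ((2 * L + 1 : ℝ) ^ d * B ^ q) ^ q⁻¹ := by
  have hV := box_volume_pos d L
  rw [Real.le_rpow_inv_iff_of_pos (abs_nonneg _)
    (mul_nonneg hV.le (Real.rpow_nonneg ((sLq_nonneg d L q v).trans h) _)) hq]
  have h1 := Real.rpow_le_rpow (sLq_nonneg d L q v) h hq.le
  rw [sLq_rpow hq, inv_mul_le_iff₀ hV] at h1
  exact (Finset.single_le_sum (f := fun x => |v x| ^ q)
    (fun _ _ => Real.rpow_nonneg (abs_nonneg _) _) hx).trans h1

/-- The pairings of `w` with the admissible test functions for the `W^{−1,q}(Λ_L)` norm. -/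
def pairings (d L : ℕ) (q : ℝ) (w : Zlat d → ℝ) : Set ℝ :=
  {A | ∃ v : Zlat d → ℝ, (∀ y ∈ bdry d L, v y = 0) ∧
    sW1q d L (q / (q - 1)) v ≤ 1 ∧
    A = ((2 * L + 1 : ℝ) ^ d)⁻¹ * ∑ x ∈ box d L, w x * v x}

lemma exists_test_bound (d : ℕ) {L : ℕ} (hL : 1 ≤ L) {q : ℝ} (hq : 1 < q) :
    ∃ M : ℝ, ∀ (w v : Zlat d → ℝ), sW1q d L (q / (q - 1)) v ≤ 1 →
      ((2 * L + 1 : ℝ) ^ d)⁻¹ * ∑ x ∈ box d L, w x * v x ≤ M * ∑ x ∈ box d L, |w x| := by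
  have hq' : 0 < q / (q - 1) := div_pos (by linarith) (by linarith)
  have hV := box_volume_pos d L
  have hL' : (0 : ℝ) < L := by exact_mod_cast hL
  refine ⟨((2 * L + 1 : ℝ) ^ d)⁻¹ *
    ((2 * L + 1 : ℝ) ^ d * (L : ℝ) ^ (q / (q - 1))) ^ (q / (q - 1))⁻¹, fun w v hv => ?_⟩
  have h1 : sLq d L (q / (q - 1)) v ≤ L := by
    have h2 := sLq_nonneg d L (q / (q - 1)) (gradNormZ d v)
    have h3 : (L : ℝ)⁻¹ * sLq d L (q / (q - 1)) v ≤ 1 := by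
      unfold sW1q at hv
      linarith
    rwa [inv_mul_le_iff₀ hL', mul_one] at h3
  rw [mul_assoc]
  gcongr
  rw [Finset.mul_sum]
  refine Finset.sum_le_sum fun x hx => (le_abs_self _).trans ?_
  rw [abs_mul, mul_comm]
  gcongr
  exact abs_le_of_sLq_le hq' h1 hx

lemma bddAbove_pairings (d : ℕ) {L : ℕ} (hL : 1 ≤ L) {q : ℝ} (hq : 1 < q) (w : Zlat d → ℝ) :
    BddAbove (pairings d L q w) := by
  obtain ⟨M, hM⟩ := exists_test_bound d hL hq
  refine ⟨M * ∑ x ∈ box d L, |w x|, ?_⟩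
  rintro _ ⟨v, -, hv, rfl⟩
  exact hM w v hv

lemma zero_mem_pairings (d L : ℕ) {q : ℝ} (hq : 1 < q) (w : Zlat d → ℝ) :
    0 ∈ pairings d L q w := by
  have hq' : 0 < q / (q - 1) := div_pos (by linarith) (by linarith)
  refine ⟨0, fun _ _ => rfl, ?_, by simp⟩
  have h1 : sLq d L (q / (q - 1)) 0 ≤ 0 := sLq_le hq' le_rfl (by simp)
  have h2 : sLq d L (q / (q - 1)) (gradNormZ d 0) ≤ 0 :=
    sLq_le hq' le_rfl (by simp [gradNormZ, dgradZ])
  have h3 : (L : ℝ)⁻¹ * sLq d L (q / (q - 1)) 0 ≤ 0 :=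
    mul_nonpos_of_nonneg_of_nonpos (by positivity) h1
  unfold sW1q
  linarith

lemma sWm1q_nonneg (d : ℕ) {L : ℕ} (hL : 1 ≤ L) {q : ℝ} (hq : 1 < q) (w : Zlat d → ℝ) :
    0 ≤ sWm1q d L q w :=
  le_csSup (bddAbove_pairings d hL hq w) (zero_mem_pairings d L hq w)

lemma exists_sWm1q_sub_le (d : ℕ) {L : ℕ} (hL : 1 ≤ L) {q : ℝ} (hq : 1 < q) :
    ∃ M : ℝ, ∀ w w' : Zlat d → ℝ,
      |sWm1q d L q w - sWm1q d L q w'| ≤ M * ∑ x ∈ box d L, |w x - w' x| := by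
  obtain ⟨M, hM⟩ := exists_test_bound d hL hq
  have key : ∀ w w' : Zlat d → ℝ,
      sWm1q d L q w ≤ sWm1q d L q w' + M * ∑ x ∈ box d L, |w x - w' x| := by
    intro w w'
    refine csSup_le ⟨0, zero_mem_pairings d L hq w⟩ ?_
    rintro _ ⟨v, hv0, hv, rfl⟩
    have h1 := le_csSup (bddAbove_pairings d hL hq w') ⟨v, hv0, hv, rfl⟩
    have h2 := hM (fun x => w x - w' x) v hv
    simp only [sub_mul, Finset.sum_sub_distrib, mul_sub] at h2
    have h3 : sSup (pairings d L q w') = sWm1q d L q w' := rfl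
    linarith
  refine ⟨M, fun w w' => abs_sub_le_iff.2 ⟨by linarith [key w w'], ?_⟩⟩
  have := key w' w
  simp only [abs_sub_comm (w' _)] at this
  linarith

lemma continuous_sWm1q (d : ℕ) {L : ℕ} (hL : 1 ≤ L) {q : ℝ} (hq : 1 < q) {w : ℝ → Zlat d → ℝ}
    (hw : ∀ x, Continuous fun t => w t x) : Continuous fun t => sWm1q d L q (w t) := by
  obtain ⟨M, hM⟩ := exists_sWm1q_sub_le d hL hq
  rw [continuous_iff_continuousAt]
  intro s
  refine tendsto_iff_dist_tendsto_zero.2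
    (squeeze_zero (fun _ => dist_nonneg) (fun t => (Real.dist_eq _ _).trans_le (hM (w t) (w s))) ?_)
  have h : Continuous fun t => M * ∑ x ∈ box d L, |w t x - w s x| := by fun_prop
  simpa using h.tendsto s

lemma sum_mul_tent_le (d : ℕ) {L : ℕ} (hL : 1 ≤ L) {q : ℝ} (hq : 1 < q) (w : Zlat d → ℝ) :
    |∑ x ∈ box d L, tent d L x * w x| ≤
      (2 * L + 1 : ℝ) ^ d * ((2 + d) * sWm1q d L q w) := by
  have hq' : 0 < q / (q - 1) := div_pos (by linarith) (by linarith)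
  have hV := box_volume_pos d L
  have hL' : (1 : ℝ) ≤ L := by exact_mod_cast hL
  have hd : (0 : ℝ) < 2 + d := by positivity
  have key : ∀ s : ℝ, |s| = 1 → s * ∑ x ∈ box d L, tent d L x * w x ≤
      (2 * L + 1 : ℝ) ^ d * ((2 + d) * sWm1q d L q w) := by
    intro s hs
    have h1 : sLq d L (q / (q - 1)) (fun x => s / (2 + d) * tent d L x) ≤ 2 * L / (2 + d) := by
      refine sLq_le hq' (by positivity) fun x _ => ?_
      rw [abs_mul, abs_div, hs, abs_of_pos hd, abs_of_nonneg (tent_nonneg d L x), div_mul_eq_mul_div,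
        one_mul]
      gcongr
      exact (tent_le d L x).trans (by linarith)
    have h2 : sLq d L (q / (q - 1)) (gradNormZ d fun x => s / (2 + d) * tent d L x) ≤
        d / (2 + d) := by
      refine sLq_le hq' (by positivity) fun x _ => ?_
      rw [gradNormZ, abs_of_nonneg (Real.sqrt_nonneg _)]
      refine Real.sqrt_le_iff.2 ⟨by positivity, ?_⟩
      have h3 : ∀ i ∈ (Finset.univ : Finset (Fin d)),
          dgradZ d (fun x => s / (2 + d) * tent d L x) x i ^ 2 ≤ (1 / (2 + d : ℝ)) ^ 2 := by
        intro i _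
        rw [← sq_abs]
        have h4 : dgradZ d (fun x => s / (2 + d) * tent d L x) x i =
            s / (2 + d) * dgradZ d (tent d L) x i := (mul_sub _ _ _).symm
        rw [h4, abs_mul, abs_div, hs, abs_of_pos hd]
        gcongr
        exact mul_le_of_le_one_right (by positivity) (abs_dgradZ_tent_le d L x i)
      refine (Finset.sum_le_card_nsmul _ _ _ h3).trans ?_
      rw [Finset.card_univ, Fintype.card_fin, nsmul_eq_mul, div_pow, div_pow, one_pow,
        mul_one_div]
      gcongr
      exact_mod_cast Nat.le_self_pow two_ne_zero d
    have h5 : sW1q d L (q / (q - 1)) (fun x => s / (2 + d) * tent d L x) ≤ 1 := by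
      calc _ ≤ (L : ℝ)⁻¹ * (2 * L / (2 + d)) + d / (2 + d) := by
            unfold sW1q
            gcongr
        _ = 1 := by field_simp
    have h6 := le_csSup (bddAbove_pairings d hL hq w)
      ⟨fun x => s / (2 + d) * tent d L x, fun y hy => by simp [tent_eq_zero hy], h5, rfl⟩
    have h7 : sSup (pairings d L q w) = sWm1q d L q w := rfl
    have h8 : ∑ x ∈ box d L, w x * (s / (2 + d) * tent d L x) =
        s / (2 + d) * ∑ x ∈ box d L, tent d L x * w x := by
      rw [Finset.mul_sum]
      exact Finset.sum_congr rfl fun x _ => by ring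
    rw [h7, h8, inv_mul_le_iff₀ hV, div_mul_eq_mul_div, div_le_iff₀ hd] at h6
    linarith
  refine abs_le'.2 ⟨?_, ?_⟩
  · simpa using key 1 (by simp)
  · simpa using key (-1) (by simp)

lemma abs_tentAvg_le (d : ℕ) {L : ℕ} (hL : 1 ≤ L) {q : ℝ} (hq : 1 < q) (w : Zlat d → ℝ) :
    |tentAvg d L w| ≤ 2 * 3 ^ d * (2 + d) * ((L : ℝ)⁻¹ * sWm1q d L q w) := by
  have hL' : (0 : ℝ) < L := by exact_mod_cast hL
  have hZ := sum_tent_pos d hL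
  have hN := sWm1q_nonneg d hL hq w
  rw [tentAvg, abs_div, abs_of_pos hZ, div_le_iff₀ hZ]
  refine (sum_mul_tent_le d hL hq w).trans ?_
  calc _ = 2 * 3 ^ d * (2 + d) * ((L : ℝ)⁻¹ * sWm1q d L q w) *
        ((L : ℝ) / (2 * 3 ^ d) * (2 * L + 1 : ℝ) ^ d) := by field_simp
    _ ≤ _ := by
        gcongr
        exact sum_tent_ge d hL

/-- The average of `f` over `(−T,0)`. -/
def timeAvg (T : ℝ) (f : ℝ → ℝ) : ℝ := T⁻¹ * ∫ t in (-T)..0, f t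

lemma timeAvg_mono {T : ℝ} (hT : 0 < T) {f g : ℝ → ℝ} (hf : Continuous f) (hg : Continuous g)
    (h : ∀ t ∈ Set.Icc (-T) 0, f t ≤ g t) : timeAvg T f ≤ timeAvg T g := by
  unfold timeAvg
  gcongr
  exact intervalIntegral.integral_mono_on (by linarith) (hf.intervalIntegrable _ _)
    (hg.intervalIntegrable _ _) h

lemma timeAvg_nonneg {T : ℝ} (hT : 0 < T) {f : ℝ → ℝ} (h : ∀ t, 0 ≤ f t) : 0 ≤ timeAvg T f :=
  mul_nonneg (by positivity) (intervalIntegral.integral_nonneg (by linarith) fun t _ => h t)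

lemma timeAvg_const_mul (T c : ℝ) (f : ℝ → ℝ) :
    timeAvg T (fun t => c * f t) = c * timeAvg T f := by
  unfold timeAvg
  rw [intervalIntegral.integral_const_mul]
  ring

lemma timeAvg_add_const {T : ℝ} (hT : 0 < T) {f : ℝ → ℝ} (hf : Continuous f) (c : ℝ) :
    timeAvg T (fun t => f t + c) = timeAvg T f + c := by
  unfold timeAvg
  rw [intervalIntegral.integral_add (hf.intervalIntegrable _ _)
    (continuous_const.intervalIntegrable _ _), intervalIntegral.integral_const]
  simp only [sub_neg_eq_add, zero_add, smul_eq_mul]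
  field_simp

lemma abs_timeAvg_rpow_le {T : ℝ} (hT : 0 < T) {q : ℝ} (hq : 1 < q) {f : ℝ → ℝ}
    (hf : Continuous f) : |timeAvg T f| ^ q ≤ timeAvg T fun t => |f t| ^ q := by
  have hq0 : 0 ≤ q := by linarith
  have h1 : |timeAvg T f| ≤ timeAvg T fun t => |f t| := by
    unfold timeAvg
    rw [abs_mul, abs_of_pos (inv_pos.2 hT)]
    gcongr
    exact intervalIntegral.abs_integral_le_integral_abs (by linarith)
  refine (Real.rpow_le_rpow (abs_nonneg _) h1 hq0).trans ?_
  have hfq : Continuous fun t => |f t| ^ q := hf.abs.rpow_const fun _ => Or.inr hq0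
  have hI : ∀ {φ : ℝ → ℝ}, Continuous φ → IntegrableOn φ (Set.uIoc (-T) 0) := fun hφ =>
    intervalIntegrable_iff.1 (hφ.intervalIntegrable _ _)
  have hle : -T ≤ 0 := by linarith
  have h2 := (convexOn_rpow hq.le).map_set_average_le (μ := volume) (t := Set.uIoc (-T) 0)
    (f := fun t => |f t|) (Real.continuous_rpow_const hq0).continuousOn isClosed_Ici
    (by simp [Set.uIoc_of_le hle, hT]) (by simp [Set.uIoc_of_le hle])
    (Filter.Eventually.of_forall fun t => abs_nonneg (f t)) (hI hf.abs) (hI hfq)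
  rw [interval_average_eq, interval_average_eq] at h2
  simpa [timeAvg] using h2

lemma add_rpow_le_two_rpow_mul {q : ℝ} (hq : 1 < q) (a b : ℝ) :
    |a + b| ^ q ≤ 2 ^ (q - 1) * (|a| ^ q + |b| ^ q) := by
  have h := Real.rpow_sum_le_const_mul_sum_rpow Finset.univ ![a, b] hq.le
  simp only [Finset.card_univ, Fintype.card_fin, Fin.sum_univ_two, Matrix.cons_val_zero,
    Matrix.cons_val_one] at h
  exact (Real.rpow_le_rpow (abs_nonneg _) (abs_add_le a b) (by linarith)).trans (by simpa using h)

lemma sLq_sub_const_rpow_le (d L : ℕ) {q : ℝ} (hq : 1 < q) (u : Zlat d → ℝ) (a b : ℝ) :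
    sLq d L q (fun x => u x - b) ^ q ≤
      2 ^ (q - 1) * (sLq d L q (fun x => u x - a) ^ q + |a - b| ^ q) := by
  have hV := box_volume_pos d L
  rw [sLq_rpow (by linarith), sLq_rpow (by linarith)]
  calc _ ≤ ((2 * L + 1 : ℝ) ^ d)⁻¹ *
        ∑ x ∈ box d L, 2 ^ (q - 1) * (|u x - a| ^ q + |a - b| ^ q) := by
        gcongr with x hx
        simpa using add_rpow_le_two_rpow_mul hq (u x - a) (a - b)
    _ = _ := by
        rw [← Finset.mul_sum, Finset.sum_add_distrib, Finset.sum_const, nsmul_eq_mul, card_box]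
        field_simp

lemma abs_boxMean_rpow_le (d L : ℕ) {q : ℝ} (hq : 1 < q) (u : Zlat d → ℝ) :
    |((2 * L + 1 : ℝ) ^ d)⁻¹ * ∑ x ∈ box d L, u x| ^ q ≤ sLq d L q u ^ q := by
  have hV := box_volume_pos d L
  have h := Real.rpow_sum_le_const_mul_sum_rpow (box d L) u hq.le
  rw [card_box] at h
  rw [sLq_rpow (by linarith), abs_mul, abs_of_pos (inv_pos.2 hV),
    Real.mul_rpow (by positivity) (abs_nonneg _)]
  calc _ ≤ (((2 * L + 1 : ℝ) ^ d)⁻¹) ^ q *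
        (((2 * L + 1 : ℝ) ^ d) ^ (q - 1) * ∑ x ∈ box d L, |u x| ^ q) := by
        gcongr
        exact (Real.rpow_le_rpow (abs_nonneg _) (Finset.abs_sum_le_sum_abs _ _)
          (by linarith)).trans h
    _ = _ := by
        rw [Real.inv_rpow hV.le, Real.rpow_sub_one hV.ne']
        have := Real.rpow_pos_of_pos hV q
        field_simp

lemma continuous_sLq {d L : ℕ} {q : ℝ} (hq : 1 < q) {u : ℝ → Zlat d → ℝ}
    (hu : ∀ x, Continuous fun t => u t x) : Continuous fun t => sLq d L q (u t) := by
  have hq0 : 0 ≤ q := by linarith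
  refine Continuous.rpow_const (continuous_const.mul (continuous_finsetSum _ fun x _ => ?_))
    fun _ => Or.inr (by positivity)
  exact (hu x).abs.rpow_const fun _ => Or.inr hq0

lemma continuous_gradNormZ {d : ℕ} {u : ℝ → Zlat d → ℝ} (hu : ∀ x, Continuous fun t => u t x)
    (x : Zlat d) : Continuous fun t => gradNormZ d (u t) x := by
  unfold gradNormZ dgradZ
  fun_prop

lemma cylAvgAt_sub (d : ℕ) {L : ℕ} (hL : 1 ≤ L) {g : ℝ → Zlat d → ℝ}
    (hg : ∀ x, Continuous fun t => g t x) (a : ℝ) :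
    cylAvgAt d L 0 0 g - a = timeAvg ((L : ℝ) ^ 2) fun t =>
      ((2 * L + 1 : ℝ) ^ d)⁻¹ * ∑ x ∈ box d L, (g t x - a) := by
  have hL' : (0 : ℝ) < L := by exact_mod_cast hL
  have hV := box_volume_pos d L
  have h : ∀ t, ((2 * L + 1 : ℝ) ^ d)⁻¹ * ∑ x ∈ box d L, (g t x - a) =
      ((2 * L + 1 : ℝ) ^ d)⁻¹ * ∑ x ∈ box d L, g t x + -a := by
    intro t
    rw [Finset.sum_sub_distrib, Finset.sum_const, nsmul_eq_mul, card_box]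
    field_simp
    ring
  simp only [h]
  rw [timeAvg_add_const (by positivity) (by fun_prop), timeAvg_const_mul, cylAvgAt, timeAvg]
  simp only [zero_sub, zero_add, mul_inv]
  ring

lemma abs_tentAvg_sub_le (d : ℕ) {L : ℕ} (hL : 1 ≤ L) {q : ℝ} (hq : 1 < q)
    {g : ℝ → Zlat d → ℝ} (hg : ∀ x, ContDiff ℝ 1 fun t => g t x) {t : ℝ}
    (ht : t ∈ Set.Icc (-(L : ℝ) ^ 2) 0) :
    |tentAvg d L (g t) - tentAvg d L (g 0)| ≤ 2 * 3 ^ d * (2 + d) * (L *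
      timeAvg ((L : ℝ) ^ 2) fun t => sWm1q d L q fun x => deriv (fun τ => g τ x) t) := by
  have hL' : (0 : ℝ) < L := by exact_mod_cast hL
  have hdc : ∀ x, Continuous fun t => deriv (fun τ => g τ x) t := fun x =>
    (hg x).continuous_deriv le_rfl
  have hderiv : ∀ s, HasDerivAt (fun s => tentAvg d L (g s))
      (tentAvg d L fun x => deriv (fun τ => g τ x) s) s := by
    intro s
    refine HasDerivAt.div_const (HasDerivAt.fun_sum fun x _ => HasDerivAt.const_mul _ ?_) _
    exact ((hg x).differentiable one_ne_zero s).hasDerivAt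
  have hcont : Continuous fun s => tentAvg d L fun x => deriv (fun τ => g τ x) s := by
    unfold tentAvg
    fun_prop
  have hN := continuous_sWm1q d hL hq hdc
  rw [abs_sub_comm, ← intervalIntegral.integral_eq_sub_of_hasDerivAt (fun s _ => hderiv s)
    (hcont.intervalIntegrable t 0)]
  calc _ ≤ ∫ s in t..0, |tentAvg d L fun x => deriv (fun τ => g τ x) s| :=
        intervalIntegral.abs_integral_le_integral_abs ht.2
    _ ≤ ∫ s in (-(L : ℝ) ^ 2)..0, |tentAvg d L fun x => deriv (fun τ => g τ x) s| :=
        intervalIntegral.integral_mono_interval ht.1 ht.2 le_rfl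
          (Filter.Eventually.of_forall fun s => abs_nonneg _) (hcont.abs.intervalIntegrable _ _)
    _ ≤ ∫ s in (-(L : ℝ) ^ 2)..0, 2 * 3 ^ d * (2 + d) *
          ((L : ℝ)⁻¹ * sWm1q d L q fun x => deriv (fun τ => g τ x) s) :=
        intervalIntegral.integral_mono_on (ht.1.trans ht.2) (hcont.abs.intervalIntegrable _ _)
          (Continuous.intervalIntegrable (by fun_prop) _ _) fun s _ => abs_tentAvg_le d hL hq _
    _ = _ := by
        rw [intervalIntegral.integral_const_mul, intervalIntegral.integral_const_mul, timeAvg]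
        field_simp

lemma sLq_sub_tentAvg_rpow_le (d : ℕ) {L : ℕ} (hL : 1 ≤ L) {q : ℝ} (hq : 1 < q)
    (u : Zlat d → ℝ) :
    sLq d L q (fun x => u x - tentAvg d L u) ^ q ≤
      4 * 3 ^ d * (d : ℝ) ^ (q - 1) * d * 3 ^ q * ((L : ℝ) ^ q * sLq d L q (gradNormZ d u) ^ q) := by
  have hV := box_volume_pos d L
  have hu : ∀ x, |gradNormZ d u x| = gradNormZ d u x := fun x => abs_of_nonneg (Real.sqrt_nonneg _)
  rw [sLq_rpow (by linarith), sLq_rpow (by linarith), inv_mul_le_iff₀ hV]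
  simp only [hu]
  refine (sum_abs_sub_tentAvg_le d hL hq u).trans_eq ?_
  field_simp

/-- The constant in the estimate of `‖g − (g)_{Q_L}‖^q`. -/
def parabolicConst (d : ℕ) (q : ℝ) : ℝ :=
  2 ^ (q - 1) * 2 * 2 ^ (q - 1) *
    (4 * 3 ^ d * (d : ℝ) ^ (q - 1) * d * 3 ^ q + (2 * 3 ^ d * (2 + d)) ^ q)

lemma timeAvg_sLq_sub_cylAvgAt_le (d : ℕ) {L : ℕ} (hL : 1 ≤ L) {q : ℝ} (hq : 1 < q)
    {g : ℝ → Zlat d → ℝ} (hg : ∀ x, ContDiff ℝ 1 fun t => g t x) :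
    timeAvg ((L : ℝ) ^ 2) (fun t => sLq d L q (fun x => g t x - cylAvgAt d L 0 0 g) ^ q) ≤
      parabolicConst d q * ((L : ℝ) ^ q *
        (timeAvg ((L : ℝ) ^ 2) (fun t => sLq d L q (gradNormZ d (g t)) ^ q) +
          timeAvg ((L : ℝ) ^ 2)
            fun t => (sWm1q d L q fun x => deriv (fun τ => g τ x) t) ^ q)) := by
  have hL' : (0 : ℝ) < L := by exact_mod_cast hL
  have hT : (0 : ℝ) < (L : ℝ) ^ 2 := by positivity
  have hq0 : 0 ≤ q := by linarith
  have hgc : ∀ x, Continuous fun t => g t x := fun x => (hg x).continuous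
  have hNc := continuous_sWm1q d hL hq fun x => (hg x).continuous_deriv le_rfl
  have hN0 : ∀ t, 0 ≤ sWm1q d L q fun x => deriv (fun τ => g τ x) t :=
    fun t => sWm1q_nonneg d hL hq _
  have hcont : ∀ a, Continuous fun t => sLq d L q (fun x => g t x - a) ^ q := fun a =>
    (continuous_sLq hq fun x => (hgc x).sub continuous_const).rpow_const fun _ => Or.inr hq0
  have hGc : Continuous fun t => sLq d L q (gradNormZ d (g t)) ^ q :=
    (continuous_sLq hq (continuous_gradNormZ hgc)).rpow_const fun _ => Or.inr hq0
  have hJ := abs_timeAvg_rpow_le hT hq hNc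
  simp only [abs_of_nonneg (hN0 _), abs_of_nonneg (timeAvg_nonneg hT hN0)] at hJ
  have hG0 : 0 ≤ timeAvg ((L : ℝ) ^ 2) fun t => sLq d L q (gradNormZ d (g t)) ^ q :=
    timeAvg_nonneg hT fun t => Real.rpow_nonneg (sLq_nonneg _ _ _ _) _
  have hD0 : 0 ≤ timeAvg ((L : ℝ) ^ 2)
      fun t => (sWm1q d L q fun x => deriv (fun τ => g τ x) t) ^ q :=
    timeAvg_nonneg hT fun t => Real.rpow_nonneg (hN0 t) _
  set W := tentAvg d L (g 0)
  set A := cylAvgAt d L 0 0 g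
  set N := timeAvg ((L : ℝ) ^ 2) fun t => sWm1q d L q fun x => deriv (fun τ => g τ x) t
  set G := timeAvg ((L : ℝ) ^ 2) fun t => sLq d L q (gradNormZ d (g t)) ^ q
  set D := timeAvg ((L : ℝ) ^ 2) fun t => (sWm1q d L q fun x => deriv (fun τ => g τ x) t) ^ q
  set S := timeAvg ((L : ℝ) ^ 2) fun t => sLq d L q (fun x => g t x - W) ^ q
  set K : ℝ := 4 * 3 ^ d * (d : ℝ) ^ (q - 1) * d * 3 ^ q with hK
  set c : ℝ := 2 * 3 ^ d * (2 + d) with hc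
  have hK0 : 0 ≤ K := by positivity
  have hc0 : 0 ≤ c := by positivity
  have hN0' : 0 ≤ N := timeAvg_nonneg hT hN0
  have hS : S ≤ 2 ^ (q - 1) * (K * (L : ℝ) ^ q * G + (c * (L * N)) ^ q) := by
    rw [← timeAvg_const_mul, ← timeAvg_add_const hT (by fun_prop), ← timeAvg_const_mul]
    refine timeAvg_mono hT (hcont W) (by fun_prop) fun t ht => ?_
    refine (sLq_sub_const_rpow_le d L hq (g t) (tentAvg d L (g t)) W).trans ?_
    gcongr
    · rw [mul_assoc]
      exact sLq_sub_tentAvg_rpow_le d hL hq (g t)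
    · exact abs_tentAvg_sub_le d hL hq hg ht
  have hA : |W - A| ^ q ≤ S := by
    rw [abs_sub_comm, cylAvgAt_sub d hL hgc W]
    have hm : Continuous fun t => ((2 * L + 1 : ℝ) ^ d)⁻¹ * ∑ x ∈ box d L, (g t x - W) := by
      fun_prop
    exact (abs_timeAvg_rpow_le hT hq hm).trans
      (timeAvg_mono hT (hm.abs.rpow_const fun _ => Or.inr hq0) (hcont W)
        fun t _ => abs_boxMean_rpow_le d L hq _)
  calc timeAvg ((L : ℝ) ^ 2) (fun t => sLq d L q (fun x => g t x - A) ^ q)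
      ≤ timeAvg ((L : ℝ) ^ 2)
          fun t => 2 ^ (q - 1) * (sLq d L q (fun x => g t x - W) ^ q + |W - A| ^ q) :=
        timeAvg_mono hT (hcont A) (continuous_const.mul ((hcont W).add continuous_const))
          fun t _ => sLq_sub_const_rpow_le d L hq (g t) W A
    _ = 2 ^ (q - 1) * (S + |W - A| ^ q) := by
        rw [timeAvg_const_mul, timeAvg_add_const hT (hcont W)]
    _ ≤ 2 ^ (q - 1) * (S + S) := by gcongr
    _ = 2 ^ (q - 1) * 2 * S := by ring
    _ ≤ 2 ^ (q - 1) * 2 * (2 ^ (q - 1) * (K * (L : ℝ) ^ q * G + (c * (L * N)) ^ q)) := by gcongr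
    _ = 2 ^ (q - 1) * 2 * 2 ^ (q - 1) * ((L : ℝ) ^ q * (K * G + c ^ q * N ^ q)) := by
        rw [Real.mul_rpow hc0 (by positivity), Real.mul_rpow hL'.le hN0']
        ring
    _ ≤ 2 ^ (q - 1) * 2 * 2 ^ (q - 1) * ((L : ℝ) ^ q * ((K + c ^ q) * (G + D))) := by
        have hcq : 0 ≤ c ^ q := Real.rpow_nonneg hc0 q
        gcongr
        nlinarith [mul_nonneg hK0 hD0, mul_nonneg hcq hG0, mul_le_mul_of_nonneg_left hJ hcq]
    _ = _ := by
        rw [parabolicConst]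
        ring

lemma parabolicConst_nonneg (d : ℕ) (q : ℝ) : 0 ≤ parabolicConst d q := by
  unfold parabolicConst
  positivity

lemma pLq_sub_cylAvgAt_le (d : ℕ) {L : ℕ} (hL : 1 ≤ L) {q : ℝ} (hq : 1 < q)
    {g : ℝ → Zlat d → ℝ} (hg : ∀ x, ContDiff ℝ 1 fun t => g t x) :
    pLq d L q (fun t x => g t x - cylAvgAt d L 0 0 g) ≤
      parabolicConst d q ^ (1 / q) * L * pLq d L q (fun t => gradNormZ d (g t)) +
        parabolicConst d q ^ (1 / q) * L * pLWm1 d L q fun t x => deriv (fun τ => g τ x) t := by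
  have hL' : (0 : ℝ) < L := by exact_mod_cast hL
  have hT : (0 : ℝ) < (L : ℝ) ^ 2 := by positivity
  have hq0 : 0 < q := by linarith
  have hC := parabolicConst_nonneg d q
  have hG0 : 0 ≤ timeAvg ((L : ℝ) ^ 2) fun t => sLq d L q (gradNormZ d (g t)) ^ q :=
    timeAvg_nonneg hT fun t => Real.rpow_nonneg (sLq_nonneg _ _ _ _) _
  have hD0 : 0 ≤ timeAvg ((L : ℝ) ^ 2)
      fun t => (sWm1q d L q fun x => deriv (fun τ => g τ x) t) ^ q :=
    timeAvg_nonneg hT fun t => Real.rpow_nonneg (sWm1q_nonneg d hL hq _) _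
  have h1 := Real.rpow_le_rpow
    (timeAvg_nonneg hT fun t => Real.rpow_nonneg (sLq_nonneg _ _ _ _) _)
    (timeAvg_sLq_sub_cylAvgAt_le d hL hq hg) (by positivity : 0 ≤ 1 / q)
  rw [Real.mul_rpow hC (by positivity), Real.mul_rpow (by positivity) (by positivity),
    one_div, Real.rpow_rpow_inv hL'.le hq0.ne', ← one_div] at h1
  have h2 := Real.rpow_add_le_add_rpow hG0 hD0 (by positivity : 0 ≤ 1 / q)
    ((div_le_one hq0).2 hq.le)
  refine (h1 : pLq d L q (fun t x => g t x - cylAvgAt d L 0 0 g) ≤ _).trans ?_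
  rw [← mul_add, mul_assoc]
  gcongr
  exact h2

/-- one-scale parabolic Poincaré inequality on `Q_{3^m}`. -/
theorem stmt4 (d : ℕ) (hd : 2 ≤ d) (q : ℝ) (hq : 1 < q) :
    ∃ C : ℝ, ∀ (m : ℕ) (g : ℝ → Zlat d → ℝ),
      (∀ x, ContDiff ℝ 1 fun t => g t x) →
      pLq d (3 ^ m) q (fun t x => g t x - cylAvgAt d (3 ^ m) 0 0 g) ≤
        C * (3 : ℝ) ^ m * pLq d (3 ^ m) q (fun t => gradNormZ d (g t)) +
          C * (3 : ℝ) ^ m * pLWm1 d (3 ^ m) q (fun t x => deriv (fun τ => g τ x) t) := by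
  refine ⟨parabolicConst d q ^ (1 / q), fun m g hg => ?_⟩
  simpa using pLq_sub_cylAvgAt_le d (Nat.one_le_pow m 3 (by norm_num)) hq hg

end
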